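/- arXiv:1608.07521 — 12 statements merged into one kernel-verified Lean document; each statement's English description precedes it below -/
import Mathlib

section
/- For every ξ > 0 and every T > 0 there exists a unique μ > 0 satisfying T = 2/μ − (2/(μ·π))·arctan(4μ/ξ); moreover this unique μ satisfies 1/T < μ < 2/T. -/
open Real in
/-- Clearing denominators turns the equation for `μ` into one whose left side is increasing. -/
lemma eq_two_div_sub_arctan_iff {ξ T μ : ℝ} (hμ : 0 < μ) :
    T = 2 / μ - 2 / (μ * π) * arctan (4 * μ / ξ) ↔
      T * μ * π + 2 * arctan (4 * μ / ξ) = 2 * π := by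
  have hπ : π ≠ 0 := pi_ne_zero
  have key : 2 / μ - 2 / (μ * π) * arctan (4 * μ / ξ) =
      (2 * π - 2 * arctan (4 * μ / ξ)) / (μ * π) := by
    field_simp
  rw [key, eq_div_iff (by positivity)]
  constructor <;> intro h <;> linarith

open Real in
lemma strictMono_mul_pi_add_arctan {ξ T : ℝ} (hξ : 0 < ξ) (hT : 0 < T) :
    StrictMono fun μ : ℝ => T * μ * π + 2 * arctan (4 * μ / ξ) := by
  intro a b hab
  have h₁ : arctan (4 * a / ξ) < arctan (4 * b / ξ) := arctan_strictMono (by gcongr)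
  have h₂ : T * a * π < T * b * π := by
    have := pi_pos
    gcongr
  change T * a * π + 2 * arctan (4 * a / ξ) < T * b * π + 2 * arctan (4 * b / ξ)
  linarith


/-- For every `ξ > 0` and `T > 0` there is a unique `μ > 0` with
`T = 2/μ − (2/(μ·π))·arctan(4μ/ξ)`, and this unique `μ` satisfies `1/T < μ < 2/T`. -/
theorem stmt_0 (ξ T : ℝ) (hξ : 0 < ξ) (hT : 0 < T) :
    (∃! μ : ℝ, 0 < μ ∧ T = 2 / μ - 2 / (μ * Real.pi) * Real.arctan (4 * μ / ξ)) ∧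
    (∀ μ : ℝ, (0 < μ ∧ T = 2 / μ - 2 / (μ * Real.pi) * Real.arctan (4 * μ / ξ)) →
      1 / T < μ ∧ μ < 2 / T) := by
  have hmono := strictMono_mul_pi_add_arctan hξ hT
  have hπ := Real.pi_pos
  have hcont : Continuous fun μ : ℝ => T * μ * Real.pi + 2 * Real.arctan (4 * μ / ξ) := by
    fun_prop
  have hlow : T * (1 / T) * Real.pi + 2 * Real.arctan (4 * (1 / T) / ξ) < 2 * Real.pi := by
    rw [mul_one_div_cancel hT.ne']
    linarith [Real.arctan_lt_pi_div_two (4 * (1 / T) / ξ)]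
  have hhigh : 2 * Real.pi < T * (2 / T) * Real.pi + 2 * Real.arctan (4 * (2 / T) / ξ) := by
    rw [mul_div_cancel₀ 2 hT.ne']
    linarith [Real.arctan_pos.2 (show 0 < 4 * (2 / T) / ξ by positivity)]
  refine ⟨?_, fun μ ⟨hμ, h⟩ => ?_⟩
  · obtain ⟨μ, hmem, hμ⟩ := intermediate_value_Icc
      (show 1 / T ≤ 2 / T by gcongr; norm_num) hcont.continuousOn ⟨hlow.le, hhigh.le⟩
    have hpos : 0 < μ := (one_div_pos.2 hT).trans_le hmem.1
    refine ⟨μ, ⟨hpos, (eq_two_div_sub_arctan_iff hpos).2 hμ⟩, fun ν ⟨hν, h⟩ => ?_⟩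
    exact hmono.injective (((eq_two_div_sub_arctan_iff hν).1 h).trans hμ.symm)
  · rw [eq_two_div_sub_arctan_iff hμ] at h
    exact ⟨hmono.lt_iff_lt.1 (hlow.trans_eq h.symm), hmono.lt_iff_lt.1 (h.trans_lt hhigh)⟩
end

section
/- For every fixed ξ > 0, the function μ ↦ 2/μ − (2/(μ·π))·arctan(4μ/ξ) is strictly decreasing (strictly antitone) on the interval (0, ∞), and takes values strictly between 1/μ and 2/μ at each point μ. -/
theorem two_div_sub_mul_arctan_eq (μ a : ℝ) :
    2 / μ - 2 / (μ * Real.pi) * a = (2 - 2 / Real.pi * a) / μ := by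
  rw [div_mul_eq_div_div_swap]
  ring

theorem one_lt_two_sub_mul_arctan (x : ℝ) : 1 < 2 - 2 / Real.pi * Real.arctan x := by
  have h : 2 / Real.pi * Real.arctan x < 2 / Real.pi * (Real.pi / 2) :=
    mul_lt_mul_of_pos_left (Real.arctan_lt_pi_div_two x) (div_pos two_pos Real.pi_pos)
  have hπ : 2 / Real.pi * (Real.pi / 2) = 1 := by
    field_simp
  linarith

/-- For fixed `ξ > 0`, the map `μ ↦ 2/μ − (2/(μπ))·arctan(4μ/ξ)` is strictly antitone on
`(0, ∞)` and its value at each `μ > 0` lies strictly between `1/μ` and `2/μ`. -/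
theorem stmt_1 (ξ : ℝ) (hξ : 0 < ξ) :
    StrictAntiOn (fun μ : ℝ => 2 / μ - 2 / (μ * Real.pi) * Real.arctan (4 * μ / ξ))
      (Set.Ioi 0) ∧
    (∀ μ : ℝ, 0 < μ →
      1 / μ < 2 / μ - 2 / (μ * Real.pi) * Real.arctan (4 * μ / ξ) ∧
      2 / μ - 2 / (μ * Real.pi) * Real.arctan (4 * μ / ξ) < 2 / μ) := by
  have hπ : 0 < 2 / Real.pi := div_pos two_pos Real.pi_pos
  refine ⟨fun x hx y hy hxy => ?_, fun μ hμ => ⟨?_, ?_⟩⟩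
  · rw [Set.mem_Ioi] at hx hy
    simp only [two_div_sub_mul_arctan_eq]
    have harg : 4 * x / ξ < 4 * y / ξ := by gcongr
    have harctan := mul_lt_mul_of_pos_left (Real.arctan_strictMono harg) hπ
    have hone := one_lt_two_sub_mul_arctan (4 * x / ξ)
    exact div_lt_div₀ (by linarith) hxy.le (by linarith) hx
  · rw [two_div_sub_mul_arctan_eq]
    exact div_lt_div_of_pos_right (one_lt_two_sub_mul_arctan _) hμ
  · have harctan : 0 < Real.arctan (4 * μ / ξ) := Real.arctan_pos.2 (by positivity)
    exact sub_lt_self _ (by positivity)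
end

section
/- Fix T > 0, and for each ξ > 0 let μ(ξ) denote the unique positive solution of T = 2/μ − (2/(μ·π))·arctan(4μ/ξ). Then μ(ξ) tends to 1/T as ξ tends to 0 from the right. -/
/-- Fix `T > 0`. If `μ ξ` is, for each `ξ > 0`, the (unique) positive solution of
`T = 2/μ − (2/(μπ))·arctan(4μ/ξ)`, then `μ ξ → 1/T` as `ξ → 0⁺`. -/
theorem stmt_2 (T : ℝ) (hT : 0 < T) (μ : ℝ → ℝ)
    (hμ : ∀ ξ : ℝ, 0 < ξ → 0 < μ ξ ∧
      T = 2 / μ ξ - 2 / (μ ξ * Real.pi) * Real.arctan (4 * μ ξ / ξ)) :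
    Filter.Tendsto μ (nhdsWithin 0 (Set.Ioi 0)) (nhds (1 / T)) := by
  have hπ := Real.pi_pos
  have solution_eq : ∀ ξ : ℝ, 0 < ξ →
      μ ξ = (2 - 2 / Real.pi * Real.arctan (4 * μ ξ / ξ)) / T := by
    intro ξ hξ
    obtain ⟨hpos, heq⟩ := hμ ξ hξ
    generalize Real.arctan (4 * μ ξ / ξ) = a at heq ⊢
    rw [eq_div_iff hT.ne', heq]
    field_simp
  have lower_bound : ∀ ξ : ℝ, 0 < ξ → 1 / T ≤ μ ξ := by
    intro ξ hξ
    rw [solution_eq ξ hξ]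
    have harctan := Real.arctan_lt_pi_div_two (4 * μ ξ / ξ)
    have : 2 / Real.pi * Real.arctan (4 * μ ξ / ξ) ≤ 2 / Real.pi * (Real.pi / 2) := by
      gcongr
    have hone : 2 / Real.pi * (Real.pi / 2) = 1 := by field_simp
    gcongr
    linarith
  have arg_atTop : Filter.Tendsto (fun ξ => 4 * μ ξ / ξ)
      (nhdsWithin 0 (Set.Ioi 0)) Filter.atTop := by
    refine Filter.tendsto_atTop_mono' _ ?_
      (tendsto_inv_nhdsGT_zero.const_mul_atTop (show (0 : ℝ) < 4 * (1 / T) by positivity))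
    filter_upwards [self_mem_nhdsWithin] with ξ hξ
    have hξ : 0 < ξ := hξ
    rw [← div_eq_mul_inv]
    gcongr
    exact lower_bound ξ hξ
  have arctan_lim := (Real.tendsto_arctan_atTop.mono_right nhdsWithin_le_nhds).comp arg_atTop
  have lim := ((arctan_lim.const_mul (2 / Real.pi)).const_sub 2).div_const T
  have hval : (2 - 2 / Real.pi * (Real.pi / 2)) / T = 1 / T := by
    field_simp
    norm_num
  rw [hval] at lim
  refine lim.congr' ?_
  filter_upwards [self_mem_nhdsWithin] with ξ hξ
  exact (solution_eq ξ hξ).symm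
end

section
/- Given real parameters ξ > 0 and T > 0, suppose μ is admissible for (ξ, T), and define η accordingly. Then η(0) = 0, η(πT) = 0, and η(t) > 0 for every t in the open interval (0, πT). -/
/-- `μ` is admissible for `(ξ, T)`. -/
def Admissible (ξ T μ : ℝ) : Prop :=
  0 < μ ∧ T = 2 / μ - 2 / (μ * Real.pi) * Real.arctan (4 * μ / ξ) ∧
    1 / T ≤ μ ∧ μ < 2 / T

/-- The foliation profile `η`. -/
noncomputable def eta (ξ T μ : ℝ) (t : ℝ) : ℝ :=
  if t < Real.pi * T / 2 then Real.exp (ξ * t / 4) * Real.sin (μ * t)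
  else Real.exp (ξ * (Real.pi * T - t) / 4) * Real.sin (μ * (Real.pi * T - t))

/-- `η(0) = 0`, `η(πT) = 0`, and `η(t) > 0` for all `t ∈ (0, πT)`. -/
theorem stmt_3 (ξ T μ : ℝ) (hξ : 0 < ξ) (hT : 0 < T) (hμ : Admissible ξ T μ) :
    eta ξ T μ 0 = 0 ∧ eta ξ T μ (Real.pi * T) = 0 ∧
      ∀ t ∈ Set.Ioo 0 (Real.pi * T), 0 < eta ξ T μ t := by
  obtain ⟨hμ0, -, -, hμT⟩ := hμ
  rw [lt_div_iff₀ hT] at hμT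
  have hπ := Real.pi_pos
  have hπT : 0 < Real.pi * T := mul_pos hπ hT
  have profile_pos : ∀ s, 0 < s → s ≤ Real.pi * T / 2 →
      0 < Real.exp (ξ * s / 4) * Real.sin (μ * s) := by
    intro s hs hsT
    refine mul_pos (Real.exp_pos _) (Real.sin_pos_of_pos_of_lt_pi (mul_pos hμ0 hs) ?_)
    calc μ * s ≤ μ * (Real.pi * T / 2) := by gcongr
      _ = Real.pi * (μ * T) / 2 := by ring
      _ < Real.pi * 2 / 2 := by gcongr
      _ = Real.pi := by ring
  refine ⟨?_, ?_, ?_⟩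
  · rw [eta, if_pos (by linarith)]
    simp
  · rw [eta, if_neg (by linarith)]
    simp
  · rintro t ⟨ht0, htT⟩
    rw [eta]
    split_ifs with h
    · exact profile_pos t ht0 h.le
    · exact profile_pos _ (by linarith) (by linarith)
end

section
/- Suppose ξ > 0, T > 0, and μ > 0 satisfy T = 2/μ − (2/(μ·π))·arctan(4μ/ξ). Then (ξ/4)·sin(μπT/2) + μ·cos(μπT/2) = 0; equivalently, the function t ↦ exp(ξt/4)·sin(μt) has derivative equal to 0 at the point t = πT/2. -/
/-- If `T = 2/μ − (2/(μπ))·arctan(4μ/ξ)`, then `(ξ/4)·sin(μπT/2) + μ·cos(μπT/2) = 0`;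
equivalently, `t ↦ exp(ξt/4)·sin(μt)` has derivative `0` at `t = πT/2`. -/
theorem stmt_4 (ξ T μ : ℝ) (hξ : 0 < ξ) (hT : 0 < T) (hμ : 0 < μ)
    (heq : T = 2 / μ - 2 / (μ * Real.pi) * Real.arctan (4 * μ / ξ)) :
    ξ / 4 * Real.sin (μ * (Real.pi * T / 2)) + μ * Real.cos (μ * (Real.pi * T / 2)) = 0 ∧
    HasDerivAt (fun t : ℝ => Real.exp (ξ * t / 4) * Real.sin (μ * t)) 0
      (Real.pi * T / 2) := by
  have hangle : μ * (Real.pi * T / 2) = Real.pi - Real.arctan (4 * μ / ξ) := by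
    have hpi := Real.pi_ne_zero
    rw [heq]
    field_simp
  have htan : Real.sin (Real.arctan (4 * μ / ξ)) =
      4 * μ / ξ * Real.cos (Real.arctan (4 * μ / ξ)) := by
    rw [← Real.tan_mul_cos (Real.cos_arctan_pos _).ne', Real.tan_arctan]
  have hzero : ξ / 4 * Real.sin (μ * (Real.pi * T / 2)) +
      μ * Real.cos (μ * (Real.pi * T / 2)) = 0 := by
    rw [hangle, Real.sin_pi_sub, Real.cos_pi_sub, htan]
    field_simp
    ring
  refine ⟨hzero, ?_⟩
  have hexp := (((hasDerivAt_id (Real.pi * T / 2)).const_mul ξ).div_const 4).exp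
  have hsin := ((hasDerivAt_id (Real.pi * T / 2)).const_mul μ).sin
  refine (hexp.mul hsin).congr_deriv ?_
  simp only [id]
  linear_combination Real.exp (ξ * (Real.pi * T / 2) / 4) * hzero
end

section
/- Given real parameters ξ > 0 and T > 0, suppose μ is admissible for (ξ, T), and define η accordingly. Then η is differentiable on (0, πT/2) and on (πT/2, πT), with derivative η′(t) > 0 for every t ∈ (0, πT/2) and η′(t) < 0 for every t ∈ (πT/2, πT). -/
open Real in
/-- The derivative of `exp (ξ t / 4) * sin (μ t)` is positive as long as the phase
`μ t + arctan (4 μ / ξ)` stays in `(0, π)`. -/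
theorem exists_pos_hasDerivAt_exp_mul_sin {ξ μ t : ℝ} (hξ : 0 < ξ)
    (h0 : 0 < μ * t + arctan (4 * μ / ξ)) (h1 : μ * t + arctan (4 * μ / ξ) < π) :
    ∃ d, 0 < d ∧ HasDerivAt (fun u => exp (ξ * u / 4) * sin (μ * u)) d t := by
  set α := arctan (4 * μ / ξ) with hα
  have hcos : 0 < cos α := cos_arctan_pos _
  have htan : 4 * μ * cos α = ξ * sin α := by
    have h : sin α / cos α = 4 * μ / ξ := by rw [← tan_eq_sin_div_cos, hα, tan_arctan]
    rw [div_eq_div_iff hcos.ne' hξ.ne'] at h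
    linarith
  have hsin : 0 < sin (μ * t + α) := sin_pos_of_pos_of_lt_pi h0 h1
  have hpos : 0 < ξ / 4 * sin (μ * t) + μ * cos (μ * t) := by
    have h : (ξ / 4 * sin (μ * t) + μ * cos (μ * t)) * cos α = ξ / 4 * sin (μ * t + α) := by
      rw [sin_add]
      linear_combination cos (μ * t) / 4 * htan
    exact pos_of_mul_pos_left (h ▸ by positivity) hcos.le
  have hexp : HasDerivAt (fun u => exp (ξ * u / 4)) (exp (ξ * t / 4) * (ξ * 1 / 4)) t :=
    (((hasDerivAt_id t).const_mul ξ).div_const 4).exp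
  have hs : HasDerivAt (fun u => sin (μ * u)) (cos (μ * t) * (μ * 1)) t :=
    ((hasDerivAt_id t).const_mul μ).sin
  refine ⟨exp (ξ * t / 4) * (ξ / 4 * sin (μ * t) + μ * cos (μ * t)), by positivity,
    (hexp.mul hs).congr_deriv (by ring)⟩

/-- The half-period condition contained in admissibility. -/
theorem Admissible.mul_pi_mul_half {ξ T μ : ℝ} (h : Admissible ξ T μ) :
    μ * (Real.pi * T / 2) = Real.pi - Real.arctan (4 * μ / ξ) := by
  obtain ⟨hμ, hT, -, -⟩ := h
  have hπ := Real.pi_pos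
  generalize Real.arctan (4 * μ / ξ) = α at *
  rw [hT]
  field_simp

/-- On the first half of its domain, the profile comes from a function with positive derivative. -/
theorem Admissible.exists_pos_hasDerivAt {ξ T μ t : ℝ} (hξ : 0 < ξ) (h : Admissible ξ T μ)
    (ht : t ∈ Set.Ioo 0 (Real.pi * T / 2)) :
    ∃ d, 0 < d ∧ HasDerivAt (fun u => Real.exp (ξ * u / 4) * Real.sin (μ * u)) d t := by
  have hμ := h.1
  have hα : 0 < Real.arctan (4 * μ / ξ) := Real.arctan_pos.2 (by positivity)
  have hlt := mul_lt_mul_of_pos_left ht.2 hμ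
  have hpos := mul_pos hμ ht.1
  rw [h.mul_pi_mul_half] at hlt
  exact exists_pos_hasDerivAt_exp_mul_sin hξ (by linarith) (by linarith)

/-- `η` is differentiable on `(0, πT/2)` and on `(πT/2, πT)`, with `η′ > 0` on the
first interval and `η′ < 0` on the second. -/
theorem stmt_5 (ξ T μ : ℝ) (hξ : 0 < ξ) (hT : 0 < T) (hμ : Admissible ξ T μ) :
    (∀ t ∈ Set.Ioo 0 (Real.pi * T / 2),
      DifferentiableAt ℝ (eta ξ T μ) t ∧ 0 < deriv (eta ξ T μ) t) ∧
    (∀ t ∈ Set.Ioo (Real.pi * T / 2) (Real.pi * T),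
      DifferentiableAt ℝ (eta ξ T μ) t ∧ deriv (eta ξ T μ) t < 0) := by
  constructor
  · intro t ht
    obtain ⟨d, hd, hder⟩ := hμ.exists_pos_hasDerivAt hξ ht
    have heta : HasDerivAt (eta ξ T μ) d t := by
      refine hder.congr_of_eventuallyEq ?_
      filter_upwards [Iio_mem_nhds ht.2] with u hu
      exact if_pos hu
    exact ⟨heta.differentiableAt, heta.deriv.symm ▸ hd⟩
  · intro t ht
    obtain ⟨d, hd, hder⟩ := hμ.exists_pos_hasDerivAt (t := Real.pi * T - t) hξ
      ⟨by linarith [ht.2], by linarith [ht.1]⟩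
    have heta : HasDerivAt (eta ξ T μ) (-d) t := by
      refine (hder.comp_const_sub (Real.pi * T) t).congr_of_eventuallyEq ?_
      filter_upwards [Ioi_mem_nhds ht.1] with u hu
      exact if_neg (not_lt.2 (le_of_lt hu))
    exact ⟨heta.differentiableAt, by rw [heta.deriv]; linarith⟩
end

section
/- Given real parameters ξ > 0 and T > 0, suppose μ is admissible for (ξ, T), and define η accordingly. Then for every t ∈ (0, πT/2) ∪ (πT/2, πT), the second derivative of η exists at t and η″(t) − (ξ/2)·|η′(t)| + (ξ²/16 + μ²)·η(t) = 0. -/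
/-- The derivative of the exponentially growing oscillation `exp (ξ s / 4) sin (μ s)`. -/
theorem hasDerivAt_exp_mul_sin (ξ μ s : ℝ) :
    HasDerivAt (fun s => Real.exp (ξ * s / 4) * Real.sin (μ * s))
      (Real.exp (ξ * s / 4) * (ξ / 4 * Real.sin (μ * s) + μ * Real.cos (μ * s))) s := by
  have h₁ : HasDerivAt (fun s : ℝ => ξ * s / 4) (ξ / 4) s := by
    simpa using ((hasDerivAt_id s).const_mul ξ).div_const 4
  have h₂ : HasDerivAt (fun s : ℝ => μ * s) μ s := by
    simpa using (hasDerivAt_id s).const_mul μ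
  refine (h₁.exp.mul h₂.sin).congr_deriv ?_
  ring

/-- The second derivative of `exp (ξ s / 4) sin (μ s)`, in the form of the linear equation
it solves. -/
theorem hasDerivAt_deriv_exp_mul_sin (ξ μ s : ℝ) :
    HasDerivAt
      (fun s => Real.exp (ξ * s / 4) * (ξ / 4 * Real.sin (μ * s) + μ * Real.cos (μ * s)))
      (ξ / 2 * (Real.exp (ξ * s / 4) * (ξ / 4 * Real.sin (μ * s) + μ * Real.cos (μ * s)))
        - (ξ ^ 2 / 16 + μ ^ 2) * (Real.exp (ξ * s / 4) * Real.sin (μ * s))) s := by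
  have h₁ : HasDerivAt (fun s : ℝ => ξ * s / 4) (ξ / 4) s := by
    simpa using ((hasDerivAt_id s).const_mul ξ).div_const 4
  have h₂ : HasDerivAt (fun s : ℝ => μ * s) μ s := by
    simpa using (hasDerivAt_id s).const_mul μ
  refine (h₁.exp.mul ((h₂.sin.const_mul (ξ / 4)).add (h₂.cos.const_mul μ))).congr_deriv ?_
  simp only [Pi.add_apply]
  ring

/-- For admissible `μ`, the function `exp (ξ s / 4) sin (μ s)` has nonnegative derivative on
`(0, πT/2)`. -/
theorem Admissible.deriv_exp_mul_sin_nonneg {ξ T μ s : ℝ} (hξ : 0 < ξ)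
    (hμ : Admissible ξ T μ) (hs : s ∈ Set.Ioo 0 (Real.pi * T / 2)) :
    0 ≤ Real.exp (ξ * s / 4) * (ξ / 4 * Real.sin (μ * s) + μ * Real.cos (μ * s)) := by
  obtain ⟨hμ0, hT, -, -⟩ := hμ
  set θ := Real.arctan (4 * μ / ξ) with hθ
  have hcos : 0 < Real.cos θ := Real.cos_arctan_pos _
  have hθ0 : 0 < θ := Real.arctan_pos.2 (by positivity)
  have hend : μ * (Real.pi * T / 2) = Real.pi - θ := by
    have := Real.pi_pos
    rw [hT]
    field_simp
  have hlt : μ * s < Real.pi - θ := hend ▸ mul_lt_mul_of_pos_left hs.2 hμ0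
  have hpos : 0 < μ * s := mul_pos hμ0 hs.1
  have hsin : 0 ≤ Real.sin (μ * s + θ) :=
    Real.sin_nonneg_of_nonneg_of_le_pi (by linarith) (by linarith)
  have htan : ξ * Real.sin θ = 4 * μ * Real.cos θ := by
    have h : Real.sin θ / Real.cos θ = 4 * μ / ξ := by
      rw [← Real.tan_eq_sin_div_cos, hθ, Real.tan_arctan]
    rw [div_eq_div_iff hcos.ne' hξ.ne'] at h
    linarith
  refine mul_nonneg (Real.exp_pos _).le (nonneg_of_mul_nonneg_left ?_ hcos)
  have key : (ξ / 4 * Real.sin (μ * s) + μ * Real.cos (μ * s)) * Real.cos θ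
      = ξ / 4 * Real.sin (μ * s + θ) := by
    rw [Real.sin_add]
    linear_combination (-Real.cos (μ * s) / 4) * htan
  rw [key]
  positivity

/-- On `(0, πT/2) ∪ (πT/2, πT)` the second derivative of `η` exists and
`η″(t) − (ξ/2)·|η′(t)| + (ξ²/16 + μ²)·η(t) = 0`. -/
theorem stmt_7 (ξ T μ : ℝ) (hξ : 0 < ξ) (hT : 0 < T) (hμ : Admissible ξ T μ) :
    ∀ t ∈ Set.Ioo 0 (Real.pi * T / 2) ∪ Set.Ioo (Real.pi * T / 2) (Real.pi * T),
      DifferentiableAt ℝ (deriv (eta ξ T μ)) t ∧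
      deriv (deriv (eta ξ T μ)) t - ξ / 2 * |deriv (eta ξ T μ) t|
        + (ξ ^ 2 / 16 + μ ^ 2) * eta ξ T μ t = 0 := by
  rintro t (ht | ht)
  · have hev : ∀ x < Real.pi * T / 2, HasDerivAt (eta ξ T μ)
        (Real.exp (ξ * x / 4) * (ξ / 4 * Real.sin (μ * x) + μ * Real.cos (μ * x))) x := by
      intro x hx
      refine (hasDerivAt_exp_mul_sin ξ μ x).congr_of_eventuallyEq ?_
      filter_upwards [Iio_mem_nhds hx] with y hy
      exact if_pos hy
    have h₂ := (hasDerivAt_deriv_exp_mul_sin ξ μ t).congr_of_eventuallyEq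
      (f₁ := deriv (eta ξ T μ)) (by
        filter_upwards [Iio_mem_nhds ht.2] with y hy
        exact (hev y hy).deriv)
    refine ⟨h₂.differentiableAt, ?_⟩
    rw [h₂.deriv, (hev t ht.2).deriv, abs_of_nonneg (hμ.deriv_exp_mul_sin_nonneg hξ ht), eta,
      if_pos ht.2]
    ring
  · have hs : Real.pi * T - t ∈ Set.Ioo 0 (Real.pi * T / 2) :=
      ⟨by linarith [ht.2], by linarith [ht.1]⟩
    have hev : ∀ x > Real.pi * T / 2, HasDerivAt (eta ξ T μ)
        (-(Real.exp (ξ * (Real.pi * T - x) / 4) * (ξ / 4 * Real.sin (μ * (Real.pi * T - x))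
          + μ * Real.cos (μ * (Real.pi * T - x))))) x := by
      intro x hx
      refine ((hasDerivAt_exp_mul_sin ξ μ (Real.pi * T - x)).comp_const_sub
        (Real.pi * T) x).congr_of_eventuallyEq ?_
      filter_upwards [Ioi_mem_nhds hx] with y hy
      exact if_neg (not_lt.2 (le_of_lt hy))
    have h₂ := ((hasDerivAt_deriv_exp_mul_sin ξ μ (Real.pi * T - t)).comp_const_sub
      (Real.pi * T) t).neg.congr_of_eventuallyEq (f₁ := deriv (eta ξ T μ)) (by
        filter_upwards [Ioi_mem_nhds ht.1] with y hy
        exact (hev y hy).deriv)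
    refine ⟨h₂.differentiableAt, ?_⟩
    rw [h₂.deriv, (hev t ht.1).deriv, abs_neg,
      abs_of_nonneg (hμ.deriv_exp_mul_sin_nonneg hξ hs), eta, if_neg (not_lt.2 ht.1.le)]
    ring
end

section
/- Given real parameters ξ > 0 and T > 0, suppose μ is admissible for (ξ, T), and define η accordingly. Then η is twice differentiable at the midpoint t = πT/2, with η′(πT/2) = 0 and η″(πT/2) = −(ξ²/16 + μ²)·exp(πTξ/8)·sin(πTμ/2); in particular, η is twice continuously differentiable on the open interval (0, πT). -/
/-- Two differentiable functions whose values and derivatives agree at `m` glue to a differentiable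
function. -/
theorem hasDerivAt_ite_lt {a b a' b' : ℝ → ℝ} {m : ℝ} (ha : ∀ t, HasDerivAt a (a' t) t)
    (hb : ∀ t, HasDerivAt b (b' t) t) (h : a m = b m) (h' : a' m = b' m) (t : ℝ) :
    HasDerivAt (fun s => if s < m then a s else b s) (if t < m then a' t else b' t) t := by
  rcases lt_trichotomy t m with ht | rfl | ht
  · rw [if_pos ht]
    refine (ha t).congr_of_eventuallyEq ?_
    filter_upwards [Iio_mem_nhds ht] with s hs
    exact if_pos hs
  · rw [if_neg (lt_irrefl t), ← hasDerivWithinAt_univ, ← Set.Iic_union_Ici (a := t)]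
    refine HasDerivWithinAt.union ?_ ?_
    · refine (h' ▸ (ha t).hasDerivWithinAt).congr_of_mem (fun s hs => ?_) Set.self_mem_Iic
      rcases (Set.mem_Iic.1 hs).lt_or_eq with hs | rfl
      · exact if_pos hs
      · simp [h]
    · exact (hb t).hasDerivWithinAt.congr_of_mem (fun s hs => if_neg (Set.mem_Ici.1 hs).not_gt)
        Set.self_mem_Ici
  · rw [if_neg ht.not_gt]
    refine (hb t).congr_of_eventuallyEq ?_
    filter_upwards [Ioi_mem_nhds ht] with s hs
    exact if_neg (Set.mem_Ioi.1 hs).not_gt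

/-- Reflecting a function about a critical point preserves two-fold differentiability. -/
theorem reflect_deriv_of_critical {g g' g'' : ℝ → ℝ} {m : ℝ} (hg : ∀ t, HasDerivAt g (g' t) t)
    (hg' : ∀ t, HasDerivAt g' (g'' t) t) (hm : g' m = 0) :
    (∀ t, HasDerivAt (fun s => if s < m then g s else g (2 * m - s))
      (if t < m then g' t else -g' (2 * m - t)) t) ∧
    ∀ t, HasDerivAt (fun s => if s < m then g' s else -g' (2 * m - s))
      (if t < m then g'' t else g'' (2 * m - t)) t := by
  have hmm : 2 * m - m = m := by ring
  have hr (t : ℝ) : HasDerivAt (fun s => 2 * m - s) (-1) t := (hasDerivAt_id t).const_sub _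
  refine ⟨hasDerivAt_ite_lt hg (fun t => ?_) (by rw [hmm]) (by simp [hmm, hm]),
    hasDerivAt_ite_lt hg' (fun t => ?_) (by simp [hmm, hm]) (by rw [hmm])⟩
  · simpa [Function.comp_def] using (hg (2 * m - t)).comp t (hr t)
  · simpa [Function.comp_def] using ((hg' (2 * m - t)).comp t (hr t)).fun_neg

theorem hasDerivAt_exp_mul_sin_add_cos (c μ p q t : ℝ) :
    HasDerivAt (fun s => Real.exp (c * s) * (p * Real.sin (μ * s) + q * Real.cos (μ * s)))
      (Real.exp (c * t) *
        ((c * p - μ * q) * Real.sin (μ * t) + (c * q + μ * p) * Real.cos (μ * t))) t := by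
  have hl (k : ℝ) : HasDerivAt (fun s => k * s) k t := by
    simpa using (hasDerivAt_id t).const_mul k
  refine ((hl c).exp.fun_mul
    (((hl μ).sin.const_mul p).fun_add ((hl μ).cos.const_mul q))).congr_deriv ?_
  ring

/-- Admissibility says exactly that the first branch of `η` is critical at the midpoint. -/
theorem Admissible.critical {ξ T μ : ℝ} (hξ : 0 < ξ) (h : Admissible ξ T μ) :
    ξ / 4 * Real.sin (μ * (Real.pi * T / 2)) + μ * Real.cos (μ * (Real.pi * T / 2)) = 0 := by
  obtain ⟨hμ, hT, -⟩ := h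
  have harg : μ * (Real.pi * T / 2) = Real.pi - Real.arctan (4 * μ / ξ) := by
    rw [hT]
    field_simp
  have htan := Real.tan_mul_cos (Real.cos_arctan_pos (4 * μ / ξ)).ne'
  rw [Real.tan_arctan] at htan
  rw [harg, Real.sin_pi_sub, Real.cos_pi_sub, ← htan]
  field_simp
  ring


/-- `η` is twice differentiable at `t = πT/2`, with `η′(πT/2) = 0` and
`η″(πT/2) = −(ξ²/16 + μ²)·exp(πTξ/8)·sin(πTμ/2)`; in particular `η` is `C²` on `(0, πT)`. -/
theorem stmt_8 (ξ T μ : ℝ) (hξ : 0 < ξ) (hT : 0 < T) (hμ : Admissible ξ T μ) :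
    DifferentiableAt ℝ (eta ξ T μ) (Real.pi * T / 2) ∧
    DifferentiableAt ℝ (deriv (eta ξ T μ)) (Real.pi * T / 2) ∧
    deriv (eta ξ T μ) (Real.pi * T / 2) = 0 ∧
    deriv (deriv (eta ξ T μ)) (Real.pi * T / 2)
      = -((ξ ^ 2 / 16 + μ ^ 2) * Real.exp (Real.pi * T * ξ / 8)
          * Real.sin (Real.pi * T * μ / 2)) ∧
    ContDiffOn ℝ 2 (eta ξ T μ) (Set.Ioo 0 (Real.pi * T)) := by
  set m := Real.pi * T / 2 with hm
  set c := ξ / 4 with hc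
  have hcrit : c * Real.sin (μ * m) + μ * Real.cos (μ * m) = 0 := hμ.critical hξ
  set g'' : ℝ → ℝ := fun t => Real.exp (c * t) *
    ((c * c - μ * μ) * Real.sin (μ * t) + (c * μ + μ * c) * Real.cos (μ * t)) with hg''
  have heta : eta ξ T μ = fun s => if s < m then
      Real.exp (c * s) * (1 * Real.sin (μ * s) + 0 * Real.cos (μ * s)) else
      Real.exp (c * (2 * m - s)) *
        (1 * Real.sin (μ * (2 * m - s)) + 0 * Real.cos (μ * (2 * m - s))) := by
    funext s
    have hT2 : Real.pi * T = 2 * m := by rw [hm]; ring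
    have hhalf : 2 * m / 2 = m := by ring
    simp only [eta, hT2, hhalf, hc, one_mul, zero_mul, add_zero, mul_div_right_comm]
  obtain ⟨h1, h2⟩ := reflect_deriv_of_critical (m := m)
    (g := fun s => Real.exp (c * s) * (1 * Real.sin (μ * s) + 0 * Real.cos (μ * s)))
    (g' := fun s => Real.exp (c * s) * (c * Real.sin (μ * s) + μ * Real.cos (μ * s)))
    (g'' := g'')
    (fun t => by simpa using hasDerivAt_exp_mul_sin_add_cos c μ 1 0 t)
    (hasDerivAt_exp_mul_sin_add_cos c μ c μ) (by simp [hcrit])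
  rw [← heta] at h1
  have hd1 := funext fun t => (h1 t).deriv
  rw [← hd1] at h2
  have hd2 := funext fun t => (h2 t).deriv
  have hmm : 2 * m - m = m := by ring
  refine ⟨(h1 m).differentiableAt, (h2 m).differentiableAt, ?_, ?_, ?_⟩
  · simp [(h1 m).deriv, hmm, hcrit]
  · have he : Real.pi * T * ξ / 8 = c * m := by rw [hm, hc]; ring
    have hs : Real.pi * T * μ / 2 = μ * m := by rw [hm]; ring
    rw [(h2 m).deriv, if_neg (lt_irrefl m), hmm, he, hs, hg'']
    have hξc : ξ = 4 * c := by rw [hc]; ring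
    rw [hξc]
    linear_combination 2 * c * Real.exp (c * m) * hcrit
  · have hcont : Continuous g'' := by fun_prop
    refine ContDiff.contDiffOn ?_
    rw [show (2 : WithTop ℕ∞) = 1 + 1 from one_add_one_eq_two.symm, contDiff_succ_iff_deriv]
    refine ⟨fun t => (h1 t).differentiableAt, by simp, contDiff_one_iff_deriv.2
      ⟨fun t => (h2 t).differentiableAt, ?_⟩⟩
    rw [hd2]
    refine Continuous.if (fun t ht => ?_) hcont (by fun_prop)
    have : t = m := by simpa [Set.Iio_def] using ht
    rw [this, hmm]
end

section
/- Given real parameters ξ > 0 and T > 0, suppose μ is admissible for (ξ, T), and define η accordingly. Then the third derivative of η has a jump discontinuity at t = πT/2: the limit of η‴(t) as t → πT/2 from the left equals −(ξ/2)·(ξ²/16 + μ²)·exp(πTξ/8)·sin(πTμ/2), which is strictly negative, and the limit of η‴(t) as t → πT/2 from the right equals +(ξ/2)·(ξ²/16 + μ²)·exp(πTξ/8)·sin(πTμ/2), which is strictly positive. -/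
/-- The oscillation `exp (a t) (A sin (ω t) + B cos (ω t))` with exponential envelope. -/
noncomputable def expOscillation (a ω A B t : ℝ) : ℝ :=
  Real.exp (a * t) * (A * Real.sin (ω * t) + B * Real.cos (ω * t))

theorem continuous_expOscillation (a ω A B : ℝ) : Continuous (expOscillation a ω A B) := by
  unfold expOscillation
  fun_prop

theorem deriv_expOscillation (a ω A B : ℝ) :
    deriv (expOscillation a ω A B) = expOscillation a ω (a * A - ω * B) (a * B + ω * A) := by
  funext t
  have hlin (c : ℝ) : HasDerivAt (fun x : ℝ => c * x) c t := by
    simpa using (hasDerivAt_id t).const_mul c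
  have h : HasDerivAt (expOscillation a ω A B) _ t :=
    (hlin a).exp.mul (((hlin ω).sin.const_mul A).add ((hlin ω).cos.const_mul B))
  rw [h.deriv, expOscillation]
  ring

theorem deriv_deriv_deriv_expOscillation (a ω : ℝ) :
    deriv (deriv (deriv (expOscillation a ω 1 0))) =
      expOscillation a ω (a ^ 3 - 3 * a * ω ^ 2) (3 * a ^ 2 * ω - ω ^ 3) := by
  simp only [deriv_expOscillation]
  congr 1 <;> ring

/-- At a critical point of `exp (a t) sin (ω t)`, its third derivative is a multiple of its
value. -/
theorem deriv_deriv_deriv_expOscillation_of_critical {a ω t : ℝ}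
    (h : a * Real.sin (ω * t) + ω * Real.cos (ω * t) = 0) :
    deriv (deriv (deriv (expOscillation a ω 1 0))) t =
      -(2 * a * ((a ^ 2 + ω ^ 2) * Real.exp (a * t) * Real.sin (ω * t))) := by
  rw [deriv_deriv_deriv_expOscillation, expOscillation]
  linear_combination Real.exp (a * t) * (3 * a ^ 2 - ω ^ 2) * h

theorem deriv_deriv_deriv_comp_const_sub (f : ℝ → ℝ) (c t : ℝ) :
    deriv (deriv (deriv fun x => f (c - x))) t = -deriv (deriv (deriv f)) (c - t) := by
  have h (g : ℝ → ℝ) : deriv (fun x => g (c - x)) = fun x => -deriv g (c - x) :=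
    funext fun x => deriv_comp_const_sub g c x
  simp [h, deriv.fun_neg']

theorem eqOn_deriv_deriv_deriv {f g : ℝ → ℝ} {s : Set ℝ} (h : Set.EqOn f g s)
    (hs : IsOpen s) :
    Set.EqOn (deriv (deriv (deriv f))) (deriv (deriv (deriv g))) s :=
  ((h.deriv hs).deriv hs).deriv hs

theorem eta_eqOn_Iio (ξ T μ : ℝ) :
    Set.EqOn (eta ξ T μ) (expOscillation (ξ / 4) μ 1 0) (Set.Iio (Real.pi * T / 2)) := by
  intro t ht
  rw [eta, if_pos (Set.mem_Iio.mp ht)]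
  simp [expOscillation, mul_div_right_comm]

theorem eta_eqOn_Ioi (ξ T μ : ℝ) :
    Set.EqOn (eta ξ T μ) (fun t => expOscillation (ξ / 4) μ 1 0 (Real.pi * T - t))
      (Set.Ioi (Real.pi * T / 2)) := by
  intro t ht
  rw [eta, if_neg (Set.mem_Ioi.mp ht).not_gt]
  simp [expOscillation, mul_div_right_comm]

theorem Admissible.sin_pos {ξ T μ : ℝ} (hT : 0 < T) (h : Admissible ξ T μ) :
    0 < Real.sin (Real.pi * T * μ / 2) := by
  obtain ⟨hμ, -, -, hlt⟩ := h
  rw [lt_div_iff₀ hT] at hlt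
  apply Real.sin_pos_of_pos_of_lt_pi
  · positivity
  · nlinarith [Real.pi_pos]

/-- The third derivative of `η` jumps at `t = πT/2`: from the left it tends to the
strictly negative value `−(ξ/2)·(ξ²/16 + μ²)·exp(πTξ/8)·sin(πTμ/2)`, and from the
right to the strictly positive value `+(ξ/2)·(ξ²/16 + μ²)·exp(πTξ/8)·sin(πTμ/2)`. -/
theorem stmt_9 (ξ T μ : ℝ) (hξ : 0 < ξ) (hT : 0 < T) (hμ : Admissible ξ T μ) :
    (Filter.Tendsto (deriv (deriv (deriv (eta ξ T μ))))
       (nhdsWithin (Real.pi * T / 2) (Set.Iio (Real.pi * T / 2)))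
       (nhds (-(ξ / 2 * ((ξ ^ 2 / 16 + μ ^ 2) * Real.exp (Real.pi * T * ξ / 8)
          * Real.sin (Real.pi * T * μ / 2))))) ∧
     -(ξ / 2 * ((ξ ^ 2 / 16 + μ ^ 2) * Real.exp (Real.pi * T * ξ / 8)
          * Real.sin (Real.pi * T * μ / 2))) < 0) ∧
    (Filter.Tendsto (deriv (deriv (deriv (eta ξ T μ))))
       (nhdsWithin (Real.pi * T / 2) (Set.Ioi (Real.pi * T / 2)))
       (nhds (ξ / 2 * ((ξ ^ 2 / 16 + μ ^ 2) * Real.exp (Real.pi * T * ξ / 8)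
          * Real.sin (Real.pi * T * μ / 2)))) ∧
     0 < ξ / 2 * ((ξ ^ 2 / 16 + μ ^ 2) * Real.exp (Real.pi * T * ξ / 8)
          * Real.sin (Real.pi * T * μ / 2))) := by
  have hsin := hμ.sin_pos hT
  have hpos : 0 < ξ / 2 * ((ξ ^ 2 / 16 + μ ^ 2) * Real.exp (Real.pi * T * ξ / 8)
      * Real.sin (Real.pi * T * μ / 2)) := by positivity
  have hval : deriv (deriv (deriv (expOscillation (ξ / 4) μ 1 0))) (Real.pi * T / 2) =
      -(ξ / 2 * ((ξ ^ 2 / 16 + μ ^ 2) * Real.exp (Real.pi * T * ξ / 8)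
        * Real.sin (Real.pi * T * μ / 2))) := by
    rw [deriv_deriv_deriv_expOscillation_of_critical (hμ.critical hξ),
      show ξ / 4 * (Real.pi * T / 2) = Real.pi * T * ξ / 8 by ring,
      show μ * (Real.pi * T / 2) = Real.pi * T * μ / 2 by ring]
    ring
  have hcont : Continuous (deriv (deriv (deriv (expOscillation (ξ / 4) μ 1 0)))) := by
    rw [deriv_deriv_deriv_expOscillation]
    exact continuous_expOscillation _ _ _ _
  refine ⟨⟨?_, neg_neg_of_pos hpos⟩, ?_, hpos⟩
  · rw [← hval]
    exact (hcont.tendsto _).mono_left nhdsWithin_le_nhds |>.congr'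
      ((eqOn_deriv_deriv_deriv (eta_eqOn_Iio ξ T μ) isOpen_Iio).symm.eventuallyEq_nhdsWithin)
  · have hreflect : Continuous fun t =>
        -deriv (deriv (deriv (expOscillation (ξ / 4) μ 1 0))) (Real.pi * T - t) := by
      fun_prop
    have hlim := (hreflect.tendsto (Real.pi * T / 2)).mono_left
      (nhdsWithin_le_nhds (s := Set.Ioi (Real.pi * T / 2)))
    rw [sub_half, hval, neg_neg] at hlim
    refine hlim.congr' (Set.EqOn.eventuallyEq_nhdsWithin fun t ht => ?_)
    rw [eqOn_deriv_deriv_deriv (eta_eqOn_Ioi ξ T μ) isOpen_Ioi ht,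
      deriv_deriv_deriv_comp_const_sub]
end

section
/- Let n ≥ 2 be a natural number and let T > 0 be real. Then the following are equivalent: (a) T > 1; (b) there exists ζ ∈ ℝ such that the quadratic form Q(x₀, x′) = (1/2 − 1/T + ζ)·x₀² + (1/2 − ζ)·‖x′‖² on ℝ × EuclideanSpace ℝ (Fin (n−1)) is positive definite, i.e. Q(x₀, x′) > 0 whenever (x₀, x′) ≠ 0. -/
/-- For `n ≥ 2` and `T > 0`: `T > 1` iff there exists `ζ ∈ ℝ` such that the quadratic form
`(1/2 − 1/T + ζ)·x₀² + (1/2 − ζ)·‖x′‖²` on `ℝ × EuclideanSpace ℝ (Fin (n−1))` is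
positive definite. -/
theorem stmt_11 (n : ℕ) (hn : 2 ≤ n) (T : ℝ) (hT : 0 < T) :
    T > 1 ↔
      ∃ ζ : ℝ, ∀ x : ℝ × EuclideanSpace ℝ (Fin (n - 1)), x ≠ 0 →
        0 < (1 / 2 - 1 / T + ζ) * x.1 ^ 2 + (1 / 2 - ζ) * ‖x.2‖ ^ 2 := by
  constructor
  · intro h
    have hT1 : 1 / T < 1 := by rwa [div_lt_one hT]
    refine ⟨1 / T / 2, fun x hx => ?_⟩
    have hpos : 0 < x.1 ^ 2 + ‖x.2‖ ^ 2 := by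
      by_cases h1 : x.1 = 0
      · have h2 : x.2 ≠ 0 := fun h2 => hx (Prod.ext h1 h2)
        have := norm_pos_iff.mpr h2
        positivity
      · positivity
    calc 0 < (1 / 2 - 1 / T / 2) * (x.1 ^ 2 + ‖x.2‖ ^ 2) := mul_pos (by linarith) hpos
      _ = _ := by ring
  · rintro ⟨ζ, h⟩
    have h1 := h (1, 0) (by simp)
    have h2 := h (0, EuclideanSpace.single ⟨0, by omega⟩ 1) (by simp)
    simp only [norm_zero, PiLp.norm_single, norm_one] at h1 h2
    have hT1 : 1 / T < 1 := by linarith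
    rwa [div_lt_one hT] at hT1
end

section
/- Let M ∈ ℝ. Then the following are equivalent: (a) M < 0; (b) there exists ζ ∈ ℝ such that the quadratic form Q(x₀, x′) = (ζ − 2M)·x₀² + (−M − ζ)·‖x′‖² on ℝ × EuclideanSpace ℝ (Fin 2) is positive definite, i.e. Q(x₀, x′) > 0 whenever (x₀, x′) ≠ 0. -/
/-- For `M ∈ ℝ`: `M < 0` iff there exists `ζ ∈ ℝ` such that the quadratic form
`(ζ − 2M)·x₀² + (−M − ζ)·‖x′‖²` on `ℝ × EuclideanSpace ℝ (Fin 2)` is positive definite. -/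
theorem stmt_13 (M : ℝ) :
    M < 0 ↔
      ∃ ζ : ℝ, ∀ x : ℝ × EuclideanSpace ℝ (Fin 2), x ≠ 0 →
        0 < (ζ - 2 * M) * x.1 ^ 2 + (-M - ζ) * ‖x.2‖ ^ 2 := by
  constructor
  · intro hM
    refine ⟨0, fun x hx => ?_⟩
    have h₁ : 0 < 0 - 2 * M := by linarith
    have h₂ : 0 < -M - 0 := by linarith
    by_cases hx₁ : x.1 = 0
    · have hx₂ : x.2 ≠ 0 := fun h => hx (Prod.ext hx₁ h)
      positivity
    · positivity
  · rintro ⟨ζ, h⟩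
    have h₁ : 0 < ζ - 2 * M := by
      simpa using h (1, 0) (by simp)
    have h₂ : 0 < -M - ζ := by
      simpa using h (0, EuclideanSpace.single 0 1) (by simp)
    linarith
end

section
/- Let a > 0, K > 0, and c ∈ ℝ. Suppose ρ : (0, a) → (0, ∞) is differentiable, ρ(σ)/σ → 1 as σ → 0 from the right, and |ρ′(σ)/ρ(σ) − 1/σ − (c/6)·σ| ≤ K·σ² for all σ ∈ (0, a). Then there exist a′ ∈ (0, a] and K′ > 0 such that |ρ(σ) − σ − (c/12)·σ³| ≤ K′·σ⁴ for all σ ∈ (0, a′). -/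
/-- A function tending to `0` at `0⁺` with derivative bounded by `K x ^ n` is bounded by
`K x ^ (n + 1)`. -/
theorem abs_le_mul_pow_succ_of_abs_deriv_le {a K : ℝ} (n : ℕ) (hK : 0 ≤ K) {g g' : ℝ → ℝ}
    (hderiv : ∀ x ∈ Set.Ioo 0 a, HasDerivAt g (g' x) x)
    (hlim : Filter.Tendsto g (nhdsWithin 0 (Set.Ioi 0)) (nhds 0))
    (hbound : ∀ x ∈ Set.Ioo 0 a, |g' x| ≤ K * x ^ n) {x : ℝ} (hx : x ∈ Set.Ioo 0 a) :
    |g x| ≤ K * x ^ (n + 1) := by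
  have hsub : ∀ s ∈ Set.Ioc 0 x, s ∈ Set.Ioo 0 a := fun s hs => ⟨hs.1, hs.2.trans_lt hx.2⟩
  have hmvt : ∀ s ∈ Set.Ioc 0 x, |g x - g s| ≤ K * x ^ (n + 1) := by
    intro s hs
    have h := (convex_Ioc 0 x).norm_image_sub_le_of_norm_hasDerivWithin_le
      (f := g) (f' := g') (C := K * x ^ n)
      (fun y hy => (hderiv y (hsub y hy)).hasDerivWithinAt)
      (fun y hy => (hbound y (hsub y hy)).trans
        (mul_le_mul_of_nonneg_left (pow_le_pow_left₀ hy.1.le hy.2 n) hK))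
      hs ⟨hx.1, le_rfl⟩
    rw [Real.norm_eq_abs, Real.norm_eq_abs, abs_of_nonneg (sub_nonneg.2 hs.2)] at h
    calc |g x - g s| ≤ K * x ^ n * (x - s) := h
      _ ≤ K * x ^ n * x := by
          have := pow_nonneg hx.1.le n
          have := hs.1
          gcongr
          linarith
      _ = K * x ^ (n + 1) := by ring
  have hlim' : Filter.Tendsto (fun s => |g x - g s|) (nhdsWithin 0 (Set.Ioi 0)) (nhds |g x|) := by
    simpa using (hlim.const_sub (g x)).abs
  refine le_of_tendsto hlim' ?_
  filter_upwards [Ioc_mem_nhdsGT hx.1] with s hs using hmvt s hs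

/-- One-dimensional asymptotic ODE lemma: if `ρ : (0, a) → (0, ∞)` is differentiable with
derivative `ρ'`, `ρ(σ)/σ → 1` as `σ → 0⁺`, and
`|ρ′(σ)/ρ(σ) − 1/σ − (c/6)σ| ≤ K σ²` on `(0, a)`, then
`|ρ(σ) − σ − (c/12)σ³| ≤ K′ σ⁴` for small `σ`. -/
theorem stmt_16 (a K c : ℝ) (ha : 0 < a) (hK : 0 < K) (ρ ρ' : ℝ → ℝ)
    (hpos : ∀ σ ∈ Set.Ioo 0 a, 0 < ρ σ)
    (hderiv : ∀ σ ∈ Set.Ioo 0 a, HasDerivAt ρ (ρ' σ) σ)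
    (hlim : Filter.Tendsto (fun σ => ρ σ / σ) (nhdsWithin 0 (Set.Ioi 0)) (nhds 1))
    (hbound : ∀ σ ∈ Set.Ioo 0 a, |ρ' σ / ρ σ - 1 / σ - c / 6 * σ| ≤ K * σ ^ 2) :
    ∃ a' ∈ Set.Ioc 0 a, ∃ K' > 0,
      ∀ σ ∈ Set.Ioo 0 a', |ρ σ - σ - c / 12 * σ ^ 3| ≤ K' * σ ^ 4 := by
  have hlog : ∀ σ ∈ Set.Ioo 0 a,
      |Real.log (ρ σ / σ) - c / 12 * σ ^ 2| ≤ K * σ ^ 3 := by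
    intro σ hσ
    refine abs_le_mul_pow_succ_of_abs_deriv_le 2 hK.le
      (g := fun s => Real.log (ρ s / s) - c / 12 * s ^ 2) ?_ ?_ hbound hσ
    · intro s hs
      have hρ := hpos s hs
      have hs0 := hs.1
      have h := (((hderiv s hs).div (hasDerivAt_id s) hs0.ne').log
        (div_pos hρ hs0).ne').sub ((hasDerivAt_pow 2 s).const_mul (c / 12))
      refine h.congr_deriv ?_
      simp only [Pi.div_apply, id]
      field_simp
      ring
    · have h1 := hlim.log one_ne_zero
      have h2 : Filter.Tendsto (fun s : ℝ => c / 12 * s ^ 2) (nhdsWithin 0 (Set.Ioi 0))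
          (nhds (c / 12 * 0 ^ 2)) :=
        (Continuous.tendsto (by fun_prop) 0).mono_left nhdsWithin_le_nhds
      simpa using h1.sub h2
  set M : ℝ := |c| / 12 + K with hM
  have hM0 : 0 < M := by positivity
  refine ⟨min a (1 / (1 + M)), ⟨by positivity, min_le_left _ _⟩, M ^ 2 + K, by positivity, ?_⟩
  rintro σ ⟨hσ0, hσ⟩
  obtain ⟨hσa, hσM⟩ := lt_min_iff.1 hσ
  rw [lt_div_iff₀ (by positivity)] at hσM
  have hσ1 : σ ≤ 1 := by nlinarith
  have hf := hlog σ ⟨hσ0, hσa⟩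
  set u := Real.log (ρ σ / σ) with hu
  have hρ : ρ σ = σ * Real.exp u := by
    rw [hu, Real.exp_log (div_pos (hpos σ ⟨hσ0, hσa⟩) hσ0)]
    field_simp
  have huM : |u| ≤ M * σ ^ 2 := by
    calc |u| = |(u - c / 12 * σ ^ 2) + c / 12 * σ ^ 2| := by ring_nf
      _ ≤ |u - c / 12 * σ ^ 2| + |c / 12 * σ ^ 2| := abs_add_le _ _
      _ ≤ K * σ ^ 3 + |c| / 12 * σ ^ 2 := by
          rw [abs_mul, abs_div, abs_of_pos (show (0 : ℝ) < 12 by norm_num),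
            abs_of_nonneg (sq_nonneg σ)]
          gcongr
      _ ≤ K * σ ^ 2 + |c| / 12 * σ ^ 2 := by
          gcongr ?_ + _
          exact mul_le_mul_of_nonneg_left
            (pow_le_pow_of_le_one hσ0.le hσ1 (by norm_num)) hK.le
      _ = M * σ ^ 2 := by rw [hM]; ring
  have hu1 : |u| ≤ 1 := huM.trans (by nlinarith [mul_pos hM0 hσ0])
  have hu2 : u ^ 2 ≤ M ^ 2 * σ ^ 3 := by
    calc u ^ 2 = |u| ^ 2 := (sq_abs u).symm
      _ ≤ (M * σ ^ 2) ^ 2 := by gcongr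
      _ = M ^ 2 * σ ^ 4 := by ring
      _ ≤ M ^ 2 * σ ^ 3 := mul_le_mul_of_nonneg_left
          (pow_le_pow_of_le_one hσ0.le hσ1 (by norm_num)) (sq_nonneg M)
  calc |ρ σ - σ - c / 12 * σ ^ 3|
      = σ * |(Real.exp u - 1 - u) + (u - c / 12 * σ ^ 2)| := by
        rw [← abs_of_pos hσ0, ← abs_mul, abs_of_pos hσ0, hρ]
        ring_nf
    _ ≤ σ * (u ^ 2 + K * σ ^ 3) := by
        gcongr
        exact (abs_add_le _ _).trans (add_le_add (Real.abs_exp_sub_one_sub_id_le hu1) hf)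
    _ ≤ σ * (M ^ 2 * σ ^ 3 + K * σ ^ 3) := by gcongr
    _ = (M ^ 2 + K) * σ ^ 4 := by ring
end
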